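/- arXiv:2411.19791 — 10 statements merged into one kernel-verified Lean document; each statement's English description precedes it below -/
import Mathlib

section
/- Let T ≥ 1, d ≥ 1, ε ∈ (0,1], δ ∈ (0,1]. Consider a d-dimensional conversation transcript over T days that obeys the ε-continuation rule (in the ℓ∞ norm) and is perfectly conversation-calibrated marginally in each coordinate. Then: (i) every round r ≥ 2 with |T_r| ≥ δ·T satisfies r ≤ 2 + d/(ε²·δ); in particular, on all but at most δ·T of the days the conversation reaches ε-agreement within 2 + d/(ε²·δ) rounds; and (ii) for every round r ≥ 2 with |T_r| ≥ δ·T, the extended predictions satisfy SQE(p̄^{·,r}, y) ≤ SQE(p̄^{·,1}, y) − (r − 2)·ε²·δ·T. -/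
open Finset
open scoped Classical

/-- If `a` is calibrated against `y` conditionally on the values of `a` and `b`, then the residual
`a - y` is orthogonal to every function of `a` and `b`. -/
theorem sum_mul_residual_eq_zero {ι : Type*} (S : Finset ι) (a b y : ι → ℝ) (g : ℝ → ℝ → ℝ)
    (hcal : ∀ s ∈ S, ∑ t ∈ S, (if a t = a s ∧ b t = b s then a s - y t else 0) = 0) :
    ∑ t ∈ S, g (a t) (b t) * (a t - y t) = 0 := by
  rw [← sum_fiberwise_of_maps_to (t := S.image fun t => (a t, b t))
    (fun t ht => mem_image_of_mem (fun t => (a t, b t)) ht)]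
  refine sum_eq_zero fun x hx => ?_
  obtain ⟨s, hs, rfl⟩ := mem_image.mp hx
  have h := congrArg (g (a s) (b s) * ·) (hcal s hs)
  simp only [mul_zero, mul_sum, ← sum_filter] at h
  rw [← h, sum_filter, sum_filter]
  refine sum_congr rfl fun t _ => ?_
  by_cases hab : a t = a s ∧ b t = b s
  · simp [hab]
  · simp [hab]

/-- Pythagorean identity: passing from `b` to `a` lowers the squared error by exactly the squared
distance of `a` and `b`. -/
theorem sum_sq_error_of_calibrated {ι : Type*} (S : Finset ι) (a b y : ι → ℝ)
    (hcal : ∀ s ∈ S, ∑ t ∈ S, (if a t = a s ∧ b t = b s then a s - y t else 0) = 0) :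
    ∑ t ∈ S, (a t - y t) ^ 2 = ∑ t ∈ S, (b t - y t) ^ 2 - ∑ t ∈ S, (a t - b t) ^ 2 := by
  have h := sum_mul_residual_eq_zero S a b y (fun u v => 2 * (u - v)) hcal
  have hsum : ∑ t ∈ S, (b t - y t) ^ 2 = ∑ t ∈ S, (a t - b t) ^ 2 + ∑ t ∈ S, (a t - y t) ^ 2
      - ∑ t ∈ S, 2 * (a t - b t) * (a t - y t) := by
    rw [← sum_add_distrib, ← sum_sub_distrib]
    exact sum_congr rfl fun t _ => by ring
  linarith

/-- **`d`-dimensional agreement theorem** (`thm:dimensions` with perfect marginal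
conversation calibration).  A `d`-dimensional conversation transcript over `T`
days consists of outcomes `y t ∈ [0,1]^d`, conversation lengths `ℓ t ≥ 2`, and
predictions `p t k ∈ [0,1]^d` for `1 ≤ k ≤ ℓ t`.  `T_k = {t | k ≤ ℓ t}`.  The
`ε`-continuation rule (in ℓ∞): the conversation continues past round `k ≥ 2`
exactly when some coordinate of the last two predictions `ε`-disagrees.
Perfect marginal conversation calibration: for every `k ≥ 2`, every coordinate
`j`, and all `v, v' ∈ [0,1]`,
`∑_{t ∈ T_k} 1[p^{t,k}[j] = v]·1[p^{t,k-1}[j] = v']·(v − y_t[j]) = 0`.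
Extended predictions are `p̄^{t,k} = p^{t, min(k, ℓ_t)}`. -/
theorem dimensional_agreement
    (T d : ℕ) (hT : 1 ≤ T) (hd : 1 ≤ d)
    (ε δ : ℝ) (hε0 : 0 < ε) (hε1 : ε ≤ 1) (hδ0 : 0 < δ) (hδ1 : δ ≤ 1)
    (y : Fin T → Fin d → ℝ) (hy : ∀ t j, y t j ∈ Set.Icc (0 : ℝ) 1)
    (ℓ : Fin T → ℕ) (hℓ : ∀ t, 2 ≤ ℓ t)
    (p : Fin T → ℕ → Fin d → ℝ)
    (hp : ∀ (t : Fin T) (k : ℕ), 1 ≤ k → k ≤ ℓ t → ∀ j, p t k j ∈ Set.Icc (0 : ℝ) 1)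
    -- the ε-continuation rule in the ℓ∞ norm
    (hcont : ∀ (k : ℕ), 2 ≤ k → ∀ t : Fin T, k ≤ ℓ t →
      (k + 1 ≤ ℓ t ↔ ∃ j : Fin d, ε ≤ |p t k j - p t (k - 1) j|))
    -- perfect conversation calibration marginally in each coordinate
    (hcal : ∀ (k : ℕ), 2 ≤ k → ∀ j : Fin d,
      ∀ v ∈ Set.Icc (0 : ℝ) 1, ∀ v' ∈ Set.Icc (0 : ℝ) 1,
      ∑ t ∈ univ.filter (fun t : Fin T => k ≤ ℓ t),
        (if p t k j = v ∧ p t (k - 1) j = v' then v - y t j else 0) = 0) :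
    -- (i) every round reached by at least a δ-fraction of the days is small …
    (∀ r : ℕ, 2 ≤ r →
        δ * T ≤ ((univ.filter (fun t : Fin T => r ≤ ℓ t)).card : ℝ) →
        (r : ℝ) ≤ 2 + d / (ε ^ 2 * δ)) ∧
    -- … in particular all but at most δ·T days reach ε-agreement within
    -- 2 + d/(ε²δ) rounds …
    (((univ.filter (fun t : Fin T => 2 + d / (ε ^ 2 * δ) < (ℓ t : ℝ))).card : ℝ) ≤ δ * T) ∧
    -- (ii) … and each additional round of conversation reduces the total
    -- squared error by at least ε²·δ·T.
    (∀ r : ℕ, 2 ≤ r →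
        δ * T ≤ ((univ.filter (fun t : Fin T => r ≤ ℓ t)).card : ℝ) →
        ∑ t : Fin T, ∑ j : Fin d, (p t (min r (ℓ t)) j - y t j) ^ 2 ≤
          ∑ t : Fin T, ∑ j : Fin d, (p t (min 1 (ℓ t)) j - y t j) ^ 2
            - ((r : ℝ) - 2) * ε ^ 2 * δ * T) := by
  have hdrop : ∀ k : ℕ, 2 ≤ k →
      ∑ t : Fin T, ∑ j : Fin d, (p t (min k (ℓ t)) j - y t j) ^ 2 ≤
        ∑ t : Fin T, ∑ j : Fin d, (p t (min (k - 1) (ℓ t)) j - y t j) ^ 2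
          - ε ^ 2 * ((univ.filter (fun t : Fin T => k + 1 ≤ ℓ t)).card : ℝ) := by
    intro k hk
    have hpyth (j : Fin d) := sum_sq_error_of_calibrated (univ.filter fun t : Fin T => k ≤ ℓ t)
      (fun t => p t k j) (fun t => p t (k - 1) j) (fun t => y t j) fun s hs => by
        have hks : k ≤ ℓ s := (mem_filter.mp hs).2
        exact hcal k hk j _ (hp s k (by omega) hks j) _ (hp s (k - 1) (by omega) (by omega) j)
    have hactive : ∑ t ∈ univ.filter (fun t : Fin T => k ≤ ℓ t), ∑ j, (p t k j - y t j) ^ 2 =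
        ∑ t ∈ univ.filter (fun t : Fin T => k ≤ ℓ t), ∑ j, (p t (k - 1) j - y t j) ^ 2 -
        ∑ t ∈ univ.filter (fun t : Fin T => k ≤ ℓ t), ∑ j, (p t k j - p t (k - 1) j) ^ 2 := by
      rw [sum_comm, sum_congr rfl fun j _ => hpyth j, sum_sub_distrib]
      congr 1 <;> exact sum_comm
    have hgain : ε ^ 2 * ((univ.filter (fun t : Fin T => k + 1 ≤ ℓ t)).card : ℝ) ≤
        ∑ t ∈ univ.filter (fun t : Fin T => k ≤ ℓ t), ∑ j, (p t k j - p t (k - 1) j) ^ 2 := by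
      calc ε ^ 2 * ((univ.filter (fun t : Fin T => k + 1 ≤ ℓ t)).card : ℝ)
          = ∑ t ∈ univ.filter (fun t : Fin T => k + 1 ≤ ℓ t), ε ^ 2 := by
            rw [sum_const, nsmul_eq_mul, mul_comm]
        _ ≤ ∑ t ∈ univ.filter (fun t : Fin T => k + 1 ≤ ℓ t),
              ∑ j, (p t k j - p t (k - 1) j) ^ 2 := by
            refine sum_le_sum fun t ht => ?_
            have hkt : k + 1 ≤ ℓ t := (mem_filter.mp ht).2
            obtain ⟨j, hj⟩ := (hcont k hk t (by omega)).mp hkt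
            calc ε ^ 2 ≤ (p t k j - p t (k - 1) j) ^ 2 := by
                  rw [← sq_abs (p t k j - p t (k - 1) j)]
                  gcongr
              _ ≤ _ := single_le_sum (f := fun j => (p t k j - p t (k - 1) j) ^ 2)
                  (fun _ _ => sq_nonneg _) (mem_univ j)
        _ ≤ _ := sum_le_sum_of_subset_of_nonneg
            (monotone_filter_right _ fun t _ (h : k + 1 ≤ ℓ t) => by omega)
            fun t _ _ => sum_nonneg fun j _ => sq_nonneg _
    have hsplit (m : ℕ) := sum_filter_add_sum_filter_not univ (fun t : Fin T => k ≤ ℓ t)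
      (fun t => ∑ j, (p t (min m (ℓ t)) j - y t j) ^ 2)
    have hon (m : ℕ) (hm : m ≤ k) :
        ∑ t ∈ univ.filter (fun t : Fin T => k ≤ ℓ t), ∑ j, (p t (min m (ℓ t)) j - y t j) ^ 2 =
        ∑ t ∈ univ.filter (fun t : Fin T => k ≤ ℓ t), ∑ j, (p t m j - y t j) ^ 2 :=
      sum_congr rfl fun t ht => by rw [min_eq_left (hm.trans (mem_filter.mp ht).2)]
    have hoff :
        ∑ t ∈ univ.filter (fun t : Fin T => ¬ k ≤ ℓ t),
          ∑ j, (p t (min k (ℓ t)) j - y t j) ^ 2 =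
        ∑ t ∈ univ.filter (fun t : Fin T => ¬ k ≤ ℓ t),
          ∑ j, (p t (min (k - 1) (ℓ t)) j - y t j) ^ 2 :=
      sum_congr rfl fun t ht => by
        have hkt : ¬ k ≤ ℓ t := (mem_filter.mp ht).2
        rw [min_eq_right (by omega : ℓ t ≤ k), min_eq_right (by omega : ℓ t ≤ k - 1)]
    rw [← hsplit k, ← hsplit (k - 1), hon k le_rfl, hon (k - 1) (by omega), hoff, hactive]
    linarith
  have hprev : ∀ r : ℕ, 2 ≤ r →
      δ * T ≤ ((univ.filter (fun t : Fin T => r ≤ ℓ t)).card : ℝ) →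
      ∑ t : Fin T, ∑ j : Fin d, (p t (min (r - 1) (ℓ t)) j - y t j) ^ 2 ≤
        ∑ t : Fin T, ∑ j : Fin d, (p t (min 1 (ℓ t)) j - y t j) ^ 2
          - ((r : ℝ) - 2) * ε ^ 2 * δ * T := by
    intro r hr
    induction r, hr using Nat.le_induction with
    | base => simp
    | succ r hr ih =>
      intro hcard
      have hmono : ((univ.filter (fun t : Fin T => r + 1 ≤ ℓ t)).card : ℝ) ≤
          ((univ.filter (fun t : Fin T => r ≤ ℓ t)).card : ℝ) := by
        exact_mod_cast card_le_card
          (monotone_filter_right _ fun t _ (h : r + 1 ≤ ℓ t) => by omega)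
      have hgain := mul_le_mul_of_nonneg_left hcard (sq_nonneg ε)
      have hstep := hdrop r hr
      have hpast := ih (hcard.trans hmono)
      rw [Nat.add_sub_cancel]
      push_cast
      linarith
  have hsqe : ∀ r : ℕ, 2 ≤ r →
      δ * T ≤ ((univ.filter (fun t : Fin T => r ≤ ℓ t)).card : ℝ) →
      ∑ t : Fin T, ∑ j : Fin d, (p t (min r (ℓ t)) j - y t j) ^ 2 ≤
        ∑ t : Fin T, ∑ j : Fin d, (p t (min 1 (ℓ t)) j - y t j) ^ 2
          - ((r : ℝ) - 2) * ε ^ 2 * δ * T := by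
    intro r hr hcard
    have hstep := hdrop r hr
    have hgain : 0 ≤ ε ^ 2 * ((univ.filter (fun t : Fin T => r + 1 ≤ ℓ t)).card : ℝ) := by
      positivity
    linarith [hprev r hr hcard]
  have hround : ∀ r : ℕ, 2 ≤ r →
      δ * T ≤ ((univ.filter (fun t : Fin T => r ≤ ℓ t)).card : ℝ) →
      (r : ℝ) ≤ 2 + d / (ε ^ 2 * δ) := by
    intro r hr hcard
    have hinit : ∑ t : Fin T, ∑ j : Fin d, (p t (min 1 (ℓ t)) j - y t j) ^ 2 ≤ d * T := by
      calc ∑ t : Fin T, ∑ j : Fin d, (p t (min 1 (ℓ t)) j - y t j) ^ 2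
          ≤ ∑ _t : Fin T, ∑ _j : Fin d, (1 : ℝ) := by
            refine sum_le_sum fun t _ => sum_le_sum fun j _ => ?_
            have hℓt := hℓ t
            obtain ⟨hp0, hp1⟩ := hp t (min 1 (ℓ t)) (by omega) (min_le_right _ _) j
            obtain ⟨hy0, hy1⟩ := hy t j
            exact (sq_le_one_iff_abs_le_one _).mpr (abs_le.mpr ⟨by linarith, by linarith⟩)
        _ = d * T := by simp [mul_comm]
    have hnonneg : 0 ≤ ∑ t : Fin T, ∑ j : Fin d, (p t (min r (ℓ t)) j - y t j) ^ 2 := by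
      positivity
    have hT0 : (0 : ℝ) < T := by exact_mod_cast hT
    have hbound : ((r : ℝ) - 2) * (ε ^ 2 * δ) ≤ d :=
      le_of_mul_le_mul_right (by linarith [hsqe r hr hcard]) hT0
    linarith [(le_div_iff₀ (by positivity : 0 < ε ^ 2 * δ)).mpr hbound]
  refine ⟨hround, ?_, hsqe⟩
  have hpos : 0 ≤ (d : ℝ) / (ε ^ 2 * δ) := by positivity
  have hlong : ∀ n : ℕ, 2 + (d : ℝ) / (ε ^ 2 * δ) < n ↔ ⌊2 + (d : ℝ) / (ε ^ 2 * δ)⌋₊ + 1 ≤ n :=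
    fun n => by rw [Nat.succ_le_iff, Nat.floor_lt (by positivity)]
  have hfloor : 2 ≤ ⌊2 + (d : ℝ) / (ε ^ 2 * δ)⌋₊ := Nat.le_floor (by push_cast; linarith)
  simp only [hlong]
  by_contra! hcard
  exact ((hlong _).mpr le_rfl).not_ge (hround _ (by omega) hcard.le)
end

section
/- Let T ≥ 1, ε ∈ (0,1], δ ∈ (0,1], L ≥ 0. Consider an action conversation transcript over T days with utility function U that is linear in its second argument, L-Lipschitz in its second argument in the ℓ1 norm, and satisfies U(a, y) ∈ [0,1] for all a ∈ A and y ∈ [0,1]^d. Suppose the transcript obeys the ε-continuation rule and is f-decision-conversation-calibrated at every round k ≥ 2, and set F := 2·L·d·|A|²·f(T/|A|²). Then: (i) if F/T < ε·δ, every round r ≥ 2 with |T_r| ≥ δ·T satisfies r ≤ 2 + 2/(ε·δ − F/T); and (ii) for every round r ≥ 2 with |T_r| ≥ δ·T, the extended actions satisfy ∑_{t=1}^T U(b̄^{t,r}, y_t) ≥ ∑_{t=1}^T U(b̄^{t,1}, y_t) + (r − 2)·ε·δ·T − (r − 1)·F. -/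
open Finset
open scoped Classical

/-- For a utility that is linear and `ℓ1`-Lipschitz in its second argument, the total difference in
utility of a fixed action is controlled by the total coordinatewise bias. -/
theorem abs_sum_utility_sub_le {ι A : Type*} {d : ℕ} {U : A → (Fin d → ℝ) → ℝ} {L : ℝ}
    (hlin : ∀ (a : A) (α β : ℝ) (x z : Fin d → ℝ),
      U a (α • x + β • z) = α * U a x + β * U a z)
    (hlip : ∀ (a : A) (x z : Fin d → ℝ), |U a x - U a z| ≤ L * ∑ j, |x j - z j|)
    (a : A) (S : Finset ι) (x z : ι → Fin d → ℝ) :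
    |∑ t ∈ S, (U a (x t) - U a (z t))| ≤ L * ∑ j, |∑ t ∈ S, (x t j - z t j)| := by
  have hz : U a 0 = 0 := by simpa using hlin a 0 0 0 0
  have hadd : ∀ u v, U a (u + v) = U a u + U a v := fun u v => by simpa using hlin a 1 1 u v
  have hsum : ∀ w : ι → Fin d → ℝ, U a (∑ t ∈ S, w t) = ∑ t ∈ S, U a (w t) :=
    fun w => map_sum (⟨⟨U a, hz⟩, hadd⟩ : (Fin d → ℝ) →+ ℝ) w S
  have h := hlip a (∑ t ∈ S, x t) (∑ t ∈ S, z t)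
  simpa only [hsum, Finset.sum_apply, ← Finset.sum_sub_distrib] using h

/-- Jensen's inequality for the sizes of the fibres of a map into a finite type. -/
theorem sum_concave_card_fiber_le {ι C : Type*} [Fintype C] [DecidableEq C] [Nonempty C]
    {f : ℝ → ℝ} (hf : ConcaveOn ℝ (Set.Ici (0 : ℝ)) f) (S : Finset ι) (g : ι → C) :
    ∑ c, f (#{t ∈ S | g t = c}) ≤ Fintype.card C * f (#S / Fintype.card C) := by
  have hC : (0 : ℝ) < Fintype.card C := by exact_mod_cast Fintype.card_pos
  have h := hf.le_map_sum (t := Finset.univ) (w := fun _ : C => (Fintype.card C : ℝ)⁻¹)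
    (p := fun c => (#{t ∈ S | g t = c} : ℝ)) (fun _ _ => by positivity)
    (by simp) (fun _ _ => Set.mem_Ici.2 (Nat.cast_nonneg _))
  have hcard : ∑ c, (#{t ∈ S | g t = c} : ℝ) = #S := by
    exact_mod_cast (Finset.card_eq_sum_card_fiberwise (f := g) (t := Finset.univ) (by simp)).symm
  simp only [smul_eq_mul, ← Finset.mul_sum, hcard] at h
  rw [inv_mul_le_iff₀ hC, inv_mul_eq_div] at h
  exact h

/-- Under calibration conditional on the pair (previous action `p`, current action `q`), the
realized gain of switching from `p` to `q` is at least the predicted gain, up to the calibration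
error. -/
theorem predicted_gain_sub_le_realized_gain {ι A : Type*} [Fintype A] [DecidableEq A] [Nonempty A]
    {d : ℕ} {U : A → (Fin d → ℝ) → ℝ} {L : ℝ} (hL : 0 ≤ L)
    (hlin : ∀ (a : A) (α β : ℝ) (x z : Fin d → ℝ),
      U a (α • x + β • z) = α * U a x + β * U a z)
    (hlip : ∀ (a : A) (x z : Fin d → ℝ), |U a x - U a z| ≤ L * ∑ j, |x j - z j|)
    {f : ℝ → ℝ} (hf : ConcaveOn ℝ (Set.Ici (0 : ℝ)) f)
    (S : Finset ι) (p q : ι → A) (x y : ι → Fin d → ℝ)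
    (hcal : ∀ (c : A × A) (j : Fin d),
      |∑ t ∈ S with (p t, q t) = c, (x t j - y t j)| ≤ f (#{t ∈ S | (p t, q t) = c})) :
    ∑ t ∈ S, (U (q t) (x t) - U (p t) (x t))
        - 2 * L * d * (Fintype.card A : ℝ) ^ 2 * f (#S / (Fintype.card A : ℝ) ^ 2) ≤
      ∑ t ∈ S, (U (q t) (y t) - U (p t) (y t)) := by
  have hbias : ∀ (a : A) (c : A × A),
      |∑ t ∈ S with (p t, q t) = c, (U a (x t) - U a (y t))| ≤
        L * (d * f (#{t ∈ S | (p t, q t) = c})) := fun a c =>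
    (abs_sum_utility_sub_le hlin hlip a _ x y).trans <| mul_le_mul_of_nonneg_left
      ((Finset.sum_le_sum fun j _ => hcal c j).trans_eq (by simp)) hL
  have hfiber : ∀ c : A × A,
      ∑ t ∈ S with (p t, q t) = c,
          ((U (q t) (x t) - U (p t) (x t)) - (U (q t) (y t) - U (p t) (y t))) ≤
        2 * L * d * f (#{t ∈ S | (p t, q t) = c}) := by
    intro c
    have hrw : ∑ t ∈ S with (p t, q t) = c,
          ((U (q t) (x t) - U (p t) (x t)) - (U (q t) (y t) - U (p t) (y t))) =
        ∑ t ∈ S with (p t, q t) = c, (U c.2 (x t) - U c.2 (y t)) -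
          ∑ t ∈ S with (p t, q t) = c, (U c.1 (x t) - U c.1 (y t)) := by
      rw [← Finset.sum_sub_distrib]
      refine Finset.sum_congr rfl fun t ht => ?_
      obtain rfl := (Finset.mem_filter.1 ht).2
      ring
    rw [hrw]
    linarith [(abs_le.1 (hbias c.2 c)).2, (abs_le.1 (hbias c.1 c)).1]
  have htotal := Finset.sum_le_sum fun c (_ : c ∈ Finset.univ) => hfiber c
  rw [Finset.sum_fiberwise, Finset.sum_sub_distrib, ← Finset.mul_sum] at htotal
  have hjensen := mul_le_mul_of_nonneg_left
    (sum_concave_card_fiber_le hf S fun t => (p t, q t)) (by positivity : 0 ≤ 2 * L * d)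
  rw [Fintype.card_prod, Nat.cast_mul, ← sq, ← mul_assoc] at hjensen
  linarith

/-- **Action-feedback agreement theorem** (`thm:agreement-action`).  An action
conversation transcript over `T` days with finite nonempty action set `A`,
utility `U : A × ℝ^d → ℝ` linear and `L`-Lipschitz (ℓ1) in its second argument
and with values in `[0,1]` on `A × [0,1]^d`, consists of outcomes
`y t ∈ [0,1]^d`, lengths `ℓ t ≥ 2`, predictions `yh t k ∈ [0,1]^d` and
communicated best-response actions `b t k ∈ argmax_a U(a, yh t k)` for
`1 ≤ k ≤ ℓ t`.  `T_k = {t | k ≤ ℓ t}`.  The `ε`-continuation rule: the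
conversation continues past round `k ≥ 2` iff
`U(b^{t,k}, yh^{t,k}) − U(b^{t,k-1}, yh^{t,k}) ≥ ε`.  `f`-decision-conversation
calibration at round `k`: for all actions `a, a'` and coordinates `j`,
`|∑_{t ∈ T_k : b^{t,k-1}=a, b^{t,k}=a'} (yh^{t,k}[j] − y_t[j])| ≤ f(|T_k(a,a')|)`.
Extended actions are `b̄^{t,k} = b^{t, min(k, ℓ_t)}`; `F = 2Ld|A|²f(T/|A|²)`. -/
theorem action_agreement
    {A : Type} [Fintype A] [DecidableEq A] [Nonempty A]
    (d : ℕ) (hd : 1 ≤ d)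
    (U : A → (Fin d → ℝ) → ℝ)
    (hlin : ∀ (a : A) (α β : ℝ) (x z : Fin d → ℝ),
      U a (α • x + β • z) = α * U a x + β * U a z)
    (L : ℝ) (hL : 0 ≤ L)
    (hlip : ∀ (a : A) (x z : Fin d → ℝ), |U a x - U a z| ≤ L * ∑ j, |x j - z j|)
    (hU01 : ∀ (a : A) (x : Fin d → ℝ),
      (∀ j, x j ∈ Set.Icc (0 : ℝ) 1) → U a x ∈ Set.Icc (0 : ℝ) 1)
    (T : ℕ) (hT : 1 ≤ T)
    (ε δ : ℝ) (hε0 : 0 < ε) (hε1 : ε ≤ 1) (hδ0 : 0 < δ) (hδ1 : δ ≤ 1)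
    (y : Fin T → Fin d → ℝ) (hy : ∀ t j, y t j ∈ Set.Icc (0 : ℝ) 1)
    (ℓ : Fin T → ℕ) (hℓ : ∀ t, 2 ≤ ℓ t)
    (yh : Fin T → ℕ → Fin d → ℝ)
    (hyh : ∀ (t : Fin T) (k : ℕ), 1 ≤ k → k ≤ ℓ t → ∀ j, yh t k j ∈ Set.Icc (0 : ℝ) 1)
    (b : Fin T → ℕ → A)
    (hb : ∀ (t : Fin T) (k : ℕ), 1 ≤ k → k ≤ ℓ t → ∀ a : A, U a (yh t k) ≤ U (b t k) (yh t k))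
    -- the ε-continuation rule
    (hcont : ∀ (k : ℕ), 2 ≤ k → ∀ t : Fin T, k ≤ ℓ t →
      (k + 1 ≤ ℓ t ↔ ε ≤ U (b t k) (yh t k) - U (b t (k - 1)) (yh t k)))
    -- f is a nonnegative nondecreasing concave function on [0,∞)
    (f : ℝ → ℝ) (hf0 : ∀ x : ℝ, 0 ≤ x → 0 ≤ f x)
    (hfmono : MonotoneOn f (Set.Ici (0 : ℝ)))
    (hfconc : ConcaveOn ℝ (Set.Ici (0 : ℝ)) f)
    -- f-decision-conversation calibration at every round k ≥ 2
    (hcal : ∀ (k : ℕ), 2 ≤ k → ∀ a a' : A, ∀ j : Fin d,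
      |∑ t ∈ univ.filter (fun t : Fin T => k ≤ ℓ t ∧ b t (k - 1) = a ∧ b t k = a'),
          (yh t k j - y t j)| ≤
        f ((univ.filter (fun t : Fin T => k ≤ ℓ t ∧ b t (k - 1) = a ∧ b t k = a')).card))
    (F : ℝ)
    (hF : F = 2 * L * d * (Fintype.card A : ℝ) ^ 2 * f (T / (Fintype.card A : ℝ) ^ 2)) :
    -- (i) if F/T < ε·δ, every round reached by at least a δ-fraction of the
    -- days is at most 2 + 2/(εδ − F/T) …
    (F / T < ε * δ →
      ∀ r : ℕ, 2 ≤ r →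
        δ * T ≤ ((univ.filter (fun t : Fin T => r ≤ ℓ t)).card : ℝ) →
        (r : ℝ) ≤ 2 + 2 / (ε * δ - F / T)) ∧
    -- (ii) … and each additional round of conversation increases the realized
    -- utility of the extended actions.
    (∀ r : ℕ, 2 ≤ r →
        δ * T ≤ ((univ.filter (fun t : Fin T => r ≤ ℓ t)).card : ℝ) →
        ∑ t : Fin T, U (b t (min 1 (ℓ t))) (y t)
            + ((r : ℝ) - 2) * ε * δ * T - ((r : ℝ) - 1) * F ≤
          ∑ t : Fin T, U (b t (min r (ℓ t))) (y t)) := by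
  have hTpos : (0 : ℝ) < T := by exact_mod_cast hT
  have hround : ∀ k : ℕ, 1 ≤ k →
      ∑ t : Fin T, U (b t (min k (ℓ t))) (y t)
          + ε * (univ.filter (fun t : Fin T => k + 2 ≤ ℓ t)).card - F ≤
        ∑ t : Fin T, U (b t (min (k + 1) (ℓ t))) (y t) := by
    intro k hk
    have hgain := predicted_gain_sub_le_realized_gain hL hlin hlip hfconc
      (univ.filter fun t : Fin T => k + 1 ≤ ℓ t) (fun t => b t k) (fun t => b t (k + 1))
      (fun t => yh t (k + 1)) y (fun c j => by
        have h := hcal (k + 1) (by omega) c.1 c.2 j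
        simpa only [Finset.filter_filter, Prod.ext_iff, Nat.add_sub_cancel] using h)
    have hF' : 2 * L * d * (Fintype.card A : ℝ) ^ 2 *
        f ((univ.filter fun t : Fin T => k + 1 ≤ ℓ t).card / (Fintype.card A : ℝ) ^ 2) ≤ F := by
      rw [hF]
      refine mul_le_mul_of_nonneg_left (hfmono (Set.mem_Ici.2 (by positivity))
        (Set.mem_Ici.2 (by positivity)) ?_) (by positivity)
      gcongr
      simpa using Finset.card_le_univ (univ.filter fun t : Fin T => k + 1 ≤ ℓ t)
    have hpred : ε * (univ.filter (fun t : Fin T => k + 2 ≤ ℓ t)).card ≤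
        ∑ t ∈ univ.filter (fun t : Fin T => k + 1 ≤ ℓ t),
          (U (b t (k + 1)) (yh t (k + 1)) - U (b t k) (yh t (k + 1))) := by
      rw [mul_comm, ← nsmul_eq_mul, ← Finset.sum_const]
      refine (Finset.sum_le_sum fun t ht => ?_).trans
        (Finset.sum_le_sum_of_subset_of_nonneg ?_ fun t ht _ => ?_)
      · have ht' : k + 2 ≤ ℓ t := (Finset.mem_filter.1 ht).2
        exact (hcont (k + 1) (by omega) t (by omega)).1 ht'
      · intro t
        simp only [Finset.mem_filter, Finset.mem_univ, true_and]
        omega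
      · exact sub_nonneg.2 (hb t (k + 1) (by omega) (Finset.mem_filter.1 ht).2 _)
    have hreal : ∑ t ∈ univ.filter (fun t : Fin T => k + 1 ≤ ℓ t),
          (U (b t (k + 1)) (y t) - U (b t k) (y t)) =
        ∑ t : Fin T, U (b t (min (k + 1) (ℓ t))) (y t) -
          ∑ t : Fin T, U (b t (min k (ℓ t))) (y t) := by
      rw [Finset.sum_filter, ← Finset.sum_sub_distrib]
      refine Finset.sum_congr rfl fun t _ => ?_
      split_ifs with h
      · rw [min_eq_left h, min_eq_left (by omega : k ≤ ℓ t)]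
      · rw [min_eq_right (by omega : ℓ t ≤ k + 1), min_eq_right (by omega : ℓ t ≤ k), sub_self]
    linarith
  have hutil : ∀ r : ℕ, 2 ≤ r →
      δ * T ≤ ((univ.filter (fun t : Fin T => r ≤ ℓ t)).card : ℝ) →
      ∑ t : Fin T, U (b t (min 1 (ℓ t))) (y t)
          + ((r : ℝ) - 2) * ε * δ * T - ((r : ℝ) - 1) * F ≤
        ∑ t : Fin T, U (b t (min r (ℓ t))) (y t) := by
    intro r hr hδ
    have hiter : ∀ n : ℕ, n + 2 ≤ r →
        ∑ t : Fin T, U (b t (min 1 (ℓ t))) (y t) + n * (ε * (δ * T)) - n * F ≤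
          ∑ t : Fin T, U (b t (min (n + 1) (ℓ t))) (y t) := by
      intro n
      induction n with
      | zero => simp
      | succ n ih =>
        intro hn
        have hmono : (univ.filter (fun t : Fin T => r ≤ ℓ t)).card ≤
            (univ.filter (fun t : Fin T => n + 1 + 2 ≤ ℓ t)).card :=
          Finset.card_le_card (Finset.monotone_filter_right _ fun t _ ht => hn.trans ht)
        have hstep := mul_le_mul_of_nonneg_left (hδ.trans (Nat.cast_le.2 hmono)) hε0.le
        have := hround (n + 1) (by omega)
        have := ih (by omega)
        push_cast
        linarith
    obtain ⟨n, rfl⟩ := Nat.exists_eq_add_of_le' hr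
    have hlast := hround (n + 1) (by omega)
    have hnonneg : 0 ≤ ε * (univ.filter (fun t : Fin T => n + 1 + 2 ≤ ℓ t)).card := by positivity
    have := hiter n le_rfl
    push_cast
    linarith
  refine ⟨fun hlt r hr hδ => ?_, hutil⟩
  have hlower : 0 ≤ ∑ t : Fin T, U (b t (min 1 (ℓ t))) (y t) :=
    Finset.sum_nonneg fun t _ => (hU01 _ _ (hy t)).1
  have hupper : ∑ t : Fin T, U (b t (min r (ℓ t))) (y t) ≤ T :=
    (Finset.sum_le_sum fun t _ => (hU01 _ _ (hy t)).2).trans_eq (by simp)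
  have hgap : 0 < ε * δ - F / T := sub_pos.2 hlt
  have hFT : F = F / T * T := by field_simp
  have hεδ : ε * δ ≤ 1 := mul_le_one₀ hε1 hδ0.le hδ1
  have hmain : (((r : ℝ) - 2) * (ε * δ - F / T)) * T ≤ (1 + F / T) * T := by
    have := hutil r hr hδ
    linear_combination this + hlower + hupper + ((r : ℝ) - 1) * hFT
  have hbound := le_of_mul_le_mul_right hmain hTpos
  have hdiv : (r : ℝ) - 2 ≤ 2 / (ε * δ - F / T) := by
    rw [le_div_iff₀ hgap]
    linarith
  linarith
end

section
/- Let Λ be a finite index set, S ⊆ Λ, and let ε, g ∈ (0,1] with g ≤ ε and N := 1/g ∈ ℕ. Let p_m, p_h, y : Λ → [0,1] with p_h(t) = p_m(t) for all t ∈ Λ∖S. Suppose the bucketed perfect conversation-calibration condition holds: for every bucket index i ∈ {1,…,N} and every value v ∈ [0,1], ∑_{t ∈ S : p_h(t) = v and p_m(t) ∈ B_i} (v − y_t) = 0. Let D := {t ∈ S : |p_h(t) − p_m(t)| ≥ ε}. Then ∑_{t∈Λ} (p_h(t) − y_t)² ≤ ∑_{t∈Λ} (p_m(t) − y_t)² −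 (ε − g)²·|D| + 2·g·|S|. -/
open Finset
open scoped Classical

/-- Membership in the `i`-th width-`g` bucket of `[0,1]` (out of `N = 1/g`):
`B_i = [(i−1)g, i·g)` for `i < N`, and `B_N = [(N−1)g, 1]`. -/
def InBucket (g : ℝ) (N i : ℕ) (x : ℝ) : Prop :=
  if i = N then ((N : ℝ) - 1) * g ≤ x ∧ x ≤ 1
  else ((i : ℝ) - 1) * g ≤ x ∧ x < (i : ℝ) * g

/-- Each point of `[0,1]` lies in exactly one width-`g` bucket. -/
theorem existsUnique_inBucket {g : ℝ} {N : ℕ} (hg : 0 < g) (hN : (N : ℝ) * g = 1) {x : ℝ}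
    (hx : x ∈ Set.Icc (0 : ℝ) 1) :
    ∃ b ∈ Finset.Icc 1 N, ∀ i ∈ Finset.Icc 1 N, InBucket g N i x ↔ i = b := by
  have hN1 : 1 ≤ N := by
    rcases Nat.eq_zero_or_pos N with rfl | h
    · simp at hN
    · exact h
  have hlt : ∀ {i j : ℕ}, i < j → (i : ℝ) * g ≤ ((j : ℝ) - 1) * g := fun {i j} hij => by
    have : (i : ℝ) + 1 ≤ j := by exact_mod_cast hij
    exact mul_le_mul_of_nonneg_right (by linarith) hg.le
  suffices h : ∃ b ∈ Finset.Icc 1 N, InBucket g N b x by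
    obtain ⟨b, hb, hbx⟩ := h
    refine ⟨b, hb, fun i hi => ⟨fun hix => ?_, fun h => h ▸ hbx⟩⟩
    have hiN := (Finset.mem_Icc.1 hi).2
    have hbN := (Finset.mem_Icc.1 hb).2
    unfold InBucket at hix hbx
    by_contra hne
    rcases lt_or_gt_of_ne hne with h | h
    · have := hlt h
      rw [if_neg (by omega)] at hix
      split_ifs at hbx with hb'
      · subst hb'; linarith [hix.2, hbx.1]
      · linarith [hix.2, hbx.1]
    · have := hlt h
      rw [if_neg (by omega)] at hbx
      split_ifs at hix with hi'
      · subst hi'; linarith [hbx.2, hix.1]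
      · linarith [hbx.2, hix.1]
  by_cases hxN : ((N : ℝ) - 1) * g ≤ x
  · exact ⟨N, Finset.mem_Icc.2 ⟨hN1, le_rfl⟩, by simpa [InBucket] using ⟨hxN, hx.2⟩⟩
  · push Not at hxN
    have h0 : 0 ≤ x / g := div_nonneg hx.1 hg.le
    have h1 : (⌊x / g⌋₊ : ℝ) * g ≤ x := (le_div_iff₀ hg).1 (Nat.floor_le h0)
    have h2 : x < ((⌊x / g⌋₊ : ℝ) + 1) * g := (div_lt_iff₀ hg).1 (Nat.lt_floor_add_one _)
    have h3 : (⌊x / g⌋₊ : ℝ) + 1 < N := by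
      have := lt_of_mul_lt_mul_right (h1.trans_lt hxN) hg.le
      linarith
    have h4 : ⌊x / g⌋₊ + 1 < N := by exact_mod_cast h3
    refine ⟨⌊x / g⌋₊ + 1, Finset.mem_Icc.2 ⟨by omega, h4.le⟩, ?_⟩
    rw [InBucket, if_neg h4.ne]
    push_cast
    exact ⟨by linarith, h2⟩

/-- A point of a width-`g` bucket is within `g` of the bucket's left endpoint. -/
theorem InBucket.abs_sub_le {g : ℝ} {N i : ℕ} (hN : (N : ℝ) * g = 1) {x : ℝ}
    (h : InBucket g N i x) : |x - ((i : ℝ) - 1) * g| ≤ g := by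
  unfold InBucket at h
  split_ifs at h with hi
  · subst hi
    exact abs_le.2 ⟨by nlinarith [h.1, h.2], by nlinarith [h.1, h.2]⟩
  · exact abs_le.2 ⟨by nlinarith [h.1, h.2], by nlinarith [h.1, h.2]⟩

/-- Residuals that sum to zero on every fibre of `k` are orthogonal to every function of `k`. -/
theorem sum_comp_mul_eq_zero_of_fiberwise {ι κ : Type*} [DecidableEq κ] (S : Finset ι) (k : ι → κ)
    (F : κ → ℝ) (r : ι → ℝ) (h : ∀ t ∈ S, ∑ s ∈ S with k s = k t, r s = 0) :
    ∑ t ∈ S, F (k t) * r t = 0 := by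
  rw [← Finset.sum_fiberwise_of_maps_to (fun t ht => Finset.mem_image_of_mem k ht)]
  refine Finset.sum_eq_zero fun c hc => ?_
  obtain ⟨t, ht, rfl⟩ := Finset.mem_image.1 hc
  rw [Finset.sum_congr rfl fun s hs => by rw [(Finset.mem_filter.1 hs).2], ← Finset.mul_sum,
    h t ht, mul_zero]

/-- **One-step potential lemma for the canonical agreement protocol**
(`lem:mh`).  `pm` are the model's round-`(k-1)` predictions, `ph` the human's
round-`k` predictions (perfectly conversation-calibrated conditionally on the
width-`g` bucket of `pm`), `y` the outcomes, `S` the set of days reaching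
round `k`, and `D ⊆ S` the set of days with `ε`-disagreement (those continuing
to round `k+1`).  Off `S` the two prediction sequences agree.  Then
`SQE(ph) ≤ SQE(pm) − (ε−g)²·|D| + 2g·|S|`. -/
theorem canonical_one_step_potential
    {Λ : Type} [Fintype Λ] [DecidableEq Λ]
    (S : Finset Λ)
    (ε g : ℝ) (hε0 : 0 < ε) (hε1 : ε ≤ 1) (hg0 : 0 < g) (hg1 : g ≤ 1) (hgε : g ≤ ε)
    (N : ℕ) (hN : (N : ℝ) * g = 1)
    (pm ph y : Λ → ℝ)
    (hpm : ∀ t, pm t ∈ Set.Icc (0 : ℝ) 1)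
    (hph : ∀ t, ph t ∈ Set.Icc (0 : ℝ) 1)
    (hy : ∀ t, y t ∈ Set.Icc (0 : ℝ) 1)
    (hoff : ∀ t ∉ S, ph t = pm t)
    -- bucketed perfect conversation calibration
    (hcal : ∀ i ∈ Finset.Icc 1 N, ∀ v ∈ Set.Icc (0 : ℝ) 1,
      ∑ t ∈ S, (if ph t = v ∧ InBucket g N i (pm t) then v - y t else 0) = 0) :
    ∑ t : Λ, (ph t - y t) ^ 2 ≤
      ∑ t : Λ, (pm t - y t) ^ 2
        - (ε - g) ^ 2 * ((S.filter (fun t => ε ≤ |ph t - pm t|)).card : ℝ)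
        + 2 * g * (S.card : ℝ) := by
  choose b hb hbuck using fun t => existsUnique_inBucket hg0 hN (hpm t)
  have horth : ∑ t ∈ S, (((b t : ℝ) - 1) * g - ph t) * (ph t - y t) = 0 := by
    refine sum_comp_mul_eq_zero_of_fiberwise S (fun t => (b t, ph t))
      (fun c => ((c.1 : ℝ) - 1) * g - c.2) (fun t => ph t - y t) fun t _ => ?_
    rw [Finset.sum_filter]
    refine Eq.trans (Finset.sum_congr rfl fun s _ => ?_) (hcal (b t) (hb t) (ph t) (hph t))
    have hiff : (b s, ph s) = (b t, ph t) ↔ ph s = ph t ∧ InBucket g N (b t) (pm s) := by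
      rw [hbuck s _ (hb t), Prod.mk.injEq, and_comm, eq_comm (a := b s)]
    by_cases h : ph s = ph t ∧ InBucket g N (b t) (pm s)
    · rw [if_pos (hiff.2 h), if_pos h, h.1]
    · rw [if_neg (mt hiff.1 h), if_neg h]
  have hpt : ∀ t, (ph t - y t) ^ 2 ≤ (pm t - y t) ^ 2
      - (ε - g) ^ 2 * (if ε ≤ |ph t - pm t| then 1 else 0) + 2 * g
      - 2 * ((((b t : ℝ) - 1) * g - ph t) * (ph t - y t)) := fun t => by
    have hround : |(pm t - ((b t : ℝ) - 1) * g) * (ph t - y t)| ≤ g * 1 := by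
      rw [abs_mul]
      refine mul_le_mul (((hbuck t _ (hb t)).2 rfl).abs_sub_le hN) ?_ (abs_nonneg _) hg0.le
      exact abs_le.2 ⟨by linarith [(hph t).1, (hy t).2], by linarith [(hph t).2, (hy t).1]⟩
    have hgap : (ε - g) ^ 2 * (if ε ≤ |ph t - pm t| then 1 else 0) ≤ (ph t - pm t) ^ 2 := by
      split_ifs with h
      · rw [mul_one, ← sq_abs (ph t - pm t)]
        exact pow_le_pow_left₀ (by linarith) (by linarith) 2
      · simpa using sq_nonneg (ph t - pm t)
    linarith [(abs_le.1 hround).1]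
  have hS := Finset.sum_le_sum fun t (_ : t ∈ S) => hpt t
  rw [Finset.sum_sub_distrib, Finset.sum_add_distrib, Finset.sum_sub_distrib, ← Finset.mul_sum _ _ ((ε - g) ^ 2),
    Finset.sum_const, ← Finset.mul_sum, horth, Finset.sum_boole, nsmul_eq_mul] at hS
  have hSc : ∑ t ∈ Sᶜ, (ph t - y t) ^ 2 = ∑ t ∈ Sᶜ, (pm t - y t) ^ 2 :=
    Finset.sum_congr rfl fun t ht => by rw [hoff t (Finset.mem_compl.1 ht)]
  rw [← Finset.sum_add_sum_compl S, ← Finset.sum_add_sum_compl S fun t => (pm t - y t) ^ 2, hSc]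
  linarith
end

section
/- Let Λ be a finite index set, S ⊆ Λ, d ≥ 1, and let ε, g ∈ (0,1] with g ≤ ε and N := 1/g ∈ ℕ. Let p_m, p_h, y : Λ → [0,1]^d with p_h(t) = p_m(t) for all t ∈ Λ∖S. Suppose the per-coordinate bucketed perfect conversation-calibration condition holds: for every coordinate j ∈ {1,…,d}, every bucket index i ∈ {1,…,N}, and every value v ∈ [0,1], ∑_{t ∈ S : p_h(t)[j] = v and p_m(t)[j] ∈ B_i} (v − y_t[j]) = 0. Let D := {t ∈ S : max_{1≤j≤d} |p_h(t)[j] − p_m(t)[j]| ≥ ε}. Then ∑_{t∈Λ} ∑_{j=1}^d (p_h(t)[j] − y_t[j])² ≤ ∑_{t∈Λ} ∑_{j=1}^d (p_m(t)[j] − y_t[j])² − (ε − g)²·|D| + 2·d·g·|S|. -/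
open Finset
open scoped Classical

/-- The index of the width-`g` bucket containing `x`. -/
noncomputable def bucketIndex (g : ℝ) (N : ℕ) (x : ℝ) : ℕ :=
  min (⌊x / g⌋₊ + 1) N

theorem bucketIndex_mem_Icc {g : ℝ} {N : ℕ} (hN : 1 ≤ N) (x : ℝ) :
    bucketIndex g N x ∈ Finset.Icc 1 N := by
  simp [bucketIndex, hN]

theorem inBucket_iff_bucketIndex_eq {g : ℝ} {N i : ℕ} {x : ℝ} (hg : 0 < g)
    (hx : x ∈ Set.Icc (0 : ℝ) 1) (hi : i ∈ Finset.Icc 1 N) :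
    InBucket g N i x ↔ bucketIndex g N x = i := by
  obtain ⟨hi1, hiN⟩ := Finset.mem_Icc.mp hi
  have hxg : 0 ≤ x / g := div_nonneg hx.1 hg.le
  obtain ⟨k, rfl⟩ : ∃ k, i = k + 1 := ⟨i - 1, by omega⟩
  unfold InBucket bucketIndex
  split_ifs with h
  · subst h
    have : min (⌊x / g⌋₊ + 1) (k + 1) = k + 1 ↔ k ≤ ⌊x / g⌋₊ := by omega
    rw [this, Nat.le_floor_iff hxg, le_div_iff₀ hg]
    simp [hx.2]
  · have : min (⌊x / g⌋₊ + 1) N = k + 1 ↔ ⌊x / g⌋₊ = k := by omega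
    rw [this, Nat.floor_eq_iff hxg, le_div_iff₀ hg, div_lt_iff₀ hg]
    simp

theorem InBucket.sub_left_mem_Icc {g : ℝ} {N i : ℕ} {x : ℝ} (hN : (N : ℝ) * g = 1)
    (h : InBucket g N i x) : x - ((i : ℝ) - 1) * g ∈ Set.Icc 0 g := by
  unfold InBucket at h
  split_ifs at h with hi
  · subst hi
    constructor <;> linarith [h.1, h.2]
  · constructor <;> linarith [h.1, h.2]

/-- Residuals that sum to zero on every level set of `k` are orthogonal to every function of `k`. -/
theorem sum_comp_mul_eq_zero {Λ κ : Type*} (S : Finset Λ) (k : Λ → κ) (r : Λ → ℝ)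
    (h : ∀ t ∈ S, ∑ s ∈ S with k s = k t, r s = 0) (f : κ → ℝ) :
    ∑ t ∈ S, f (k t) * r t = 0 := by
  rw [← Finset.sum_fiberwise_of_maps_to (t := S.image k) (g := k)
    (fun t ht => Finset.mem_image_of_mem k ht)]
  refine Finset.sum_eq_zero fun c hc => ?_
  obtain ⟨t, ht, rfl⟩ := Finset.mem_image.mp hc
  rw [Finset.sum_congr rfl fun s hs => by rw [(Finset.mem_filter.mp hs).2],
    ← Finset.mul_sum, h t ht, mul_zero]

/-- One-coordinate potential drop: recalibrating on buckets of the old prediction `p` decreases the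
squared error by the squared movement, up to `2g` per day. -/
theorem sum_sq_sub_le_of_bucket_calibrated {Λ : Type*} (S : Finset Λ) {g : ℝ} (hg : 0 < g)
    {N : ℕ} (hN : (N : ℝ) * g = 1) {p q y : Λ → ℝ}
    (hp : ∀ t, p t ∈ Set.Icc (0 : ℝ) 1) (hq : ∀ t, q t ∈ Set.Icc (0 : ℝ) 1)
    (hy : ∀ t, y t ∈ Set.Icc (0 : ℝ) 1)
    (hcal : ∀ i ∈ Finset.Icc 1 N, ∀ v ∈ Set.Icc (0 : ℝ) 1,
      ∑ t ∈ S, (if q t = v ∧ InBucket g N i (p t) then v - y t else 0) = 0) :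
    ∑ t ∈ S, (q t - y t) ^ 2 ≤
      ∑ t ∈ S, (p t - y t) ^ 2 - ∑ t ∈ S, (q t - p t) ^ 2 + 2 * g * (S.card : ℝ) := by
  have hN1 : 1 ≤ N := by
    rcases Nat.eq_zero_or_pos N with rfl | h
    · simp at hN
    · exact h
  have horth := sum_comp_mul_eq_zero S (fun t => (q t, bucketIndex g N (p t)))
    (fun t => q t - y t) (fun t _ => by
      have hi := bucketIndex_mem_Icc (g := g) hN1 (p t)
      rw [← hcal _ hi _ (hq t), Finset.sum_filter]
      refine Finset.sum_congr rfl fun s _ => ?_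
      simp only [Prod.mk.injEq, inBucket_iff_bucketIndex_eq hg (hp s) hi]
      split_ifs with h
      · rw [h.1]
      · rfl)
    (fun c => 2 * (((c.2 : ℝ) - 1) * g - c.1))
  have hpt : ∀ t ∈ S, (q t - y t) ^ 2 ≤ (p t - y t) ^ 2 - (q t - p t) ^ 2 + 2 * g
      - 2 * (((bucketIndex g N (p t) : ℝ) - 1) * g - q t) * (q t - y t) := fun t _ => by
    obtain ⟨h0, h1⟩ := InBucket.sub_left_mem_Icc hN ((inBucket_iff_bucketIndex_eq hg (hp t)
      (bucketIndex_mem_Icc (g := g) hN1 (p t))).mpr rfl)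
    have hr : -1 ≤ q t - y t := by linarith [(hq t).1, (hy t).2]
    nlinarith [mul_nonneg h0 (by linarith : 0 ≤ q t - y t + 1)]
  have hsum := Finset.sum_le_sum hpt
  simp only [Finset.sum_sub_distrib, Finset.sum_add_distrib, Finset.sum_const, nsmul_eq_mul]
    at hsum horth
  linarith

/-- **One-step potential lemma for the `d`-dimensional agreement protocol**
(`lem:mhd`).  `pm` are the round-`(k-1)` predictions, `ph` the round-`k`
predictions (each coordinate perfectly conversation-calibrated conditionally
on the width-`g` bucket of the same coordinate of `pm`), `y` the outcomes,
`S` the set of days reaching round `k`, and `D ⊆ S` the set of days with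
`ε`-disagreement in ℓ∞ (those continuing to round `k+1`).  Off `S` the two
prediction sequences agree.  Then
`SQE(ph) ≤ SQE(pm) − (ε−g)²·|D| + 2dg·|S|`. -/
theorem dimensional_one_step_potential
    {Λ : Type} [Fintype Λ] [DecidableEq Λ]
    (S : Finset Λ) (d : ℕ) (hd : 1 ≤ d)
    (ε g : ℝ) (hε0 : 0 < ε) (hε1 : ε ≤ 1) (hg0 : 0 < g) (hg1 : g ≤ 1) (hgε : g ≤ ε)
    (N : ℕ) (hN : (N : ℝ) * g = 1)
    (pm ph y : Λ → Fin d → ℝ)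
    (hpm : ∀ t j, pm t j ∈ Set.Icc (0 : ℝ) 1)
    (hph : ∀ t j, ph t j ∈ Set.Icc (0 : ℝ) 1)
    (hy : ∀ t j, y t j ∈ Set.Icc (0 : ℝ) 1)
    (hoff : ∀ t ∉ S, ph t = pm t)
    -- per-coordinate bucketed perfect conversation calibration
    (hcal : ∀ j : Fin d, ∀ i ∈ Finset.Icc 1 N, ∀ v ∈ Set.Icc (0 : ℝ) 1,
      ∑ t ∈ S, (if ph t j = v ∧ InBucket g N i (pm t j) then v - y t j else 0) = 0) :
    ∑ t : Λ, ∑ j : Fin d, (ph t j - y t j) ^ 2 ≤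
      ∑ t : Λ, ∑ j : Fin d, (pm t j - y t j) ^ 2
        - (ε - g) ^ 2 *
            ((S.filter (fun t => ∃ j : Fin d, ε ≤ |ph t j - pm t j|)).card : ℝ)
        + 2 * d * g * (S.card : ℝ) := by
  have hS : ∑ t ∈ S, ∑ j : Fin d, (ph t j - y t j) ^ 2 ≤
      ∑ t ∈ S, ∑ j : Fin d, (pm t j - y t j) ^ 2
        - ∑ t ∈ S, ∑ j : Fin d, (ph t j - pm t j) ^ 2 + 2 * d * g * (S.card : ℝ) := by
    have h := Finset.sum_le_sum fun j (_ : j ∈ Finset.univ) =>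
      sum_sq_sub_le_of_bucket_calibrated S hg0 hN (fun t => hpm t j) (fun t => hph t j)
        (fun t => hy t j) (hcal j)
    simp only [Finset.sum_sub_distrib, Finset.sum_add_distrib, Finset.sum_const, nsmul_eq_mul,
      Finset.card_univ, Fintype.card_fin] at h
    rw [Finset.sum_comm, Finset.sum_comm (s := Finset.univ) (t := S),
      Finset.sum_comm (s := Finset.univ) (t := S)] at h
    linarith
  have hD : (ε - g) ^ 2 *
      ((S.filter (fun t => ∃ j : Fin d, ε ≤ |ph t j - pm t j|)).card : ℝ) ≤
      ∑ t ∈ S, ∑ j : Fin d, (ph t j - pm t j) ^ 2 := by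
    rw [mul_comm, ← nsmul_eq_mul, ← Finset.sum_const, Finset.sum_filter]
    refine Finset.sum_le_sum fun t _ => ?_
    split_ifs with h
    · obtain ⟨j, hj⟩ := h
      calc (ε - g) ^ 2 ≤ |ph t j - pm t j| ^ 2 :=
            pow_le_pow_left₀ (by linarith) (by linarith) 2
        _ = (ph t j - pm t j) ^ 2 := sq_abs _
        _ ≤ _ := Finset.single_le_sum (f := fun j => (ph t j - pm t j) ^ 2)
            (fun _ _ => sq_nonneg _) (Finset.mem_univ j)
    · positivity
  have hoff' : ∑ t ∈ Sᶜ, ∑ j : Fin d, (ph t j - y t j) ^ 2 =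
      ∑ t ∈ Sᶜ, ∑ j : Fin d, (pm t j - y t j) ^ 2 :=
    Finset.sum_congr rfl fun t ht => by rw [hoff t (Finset.mem_compl.mp ht)]
  rw [← Finset.sum_add_sum_compl S, ← Finset.sum_add_sum_compl S (fun t => ∑ j, (pm t j - _) ^ 2)]
  linarith
end

section
/- Let T ≥ 1, ε ∈ (0,1], k ≥ 2, L ≥ 0. Consider an action conversation transcript over T days with utility function U that is linear in its second argument and L-Lipschitz in its second argument in the ℓ1 norm. If the transcript obeys the ε-continuation rule and is f-decision-conversation-calibrated at round k, then the extended actions satisfy ∑_{t=1}^T U(b̄^{t,k}, y_t) − ∑_{t=1}^T U(b̄^{t,k−1}, y_t) ≥ ε·|T_{k+1}| − 2·L·d·|A|²·f(T/|A|²). -/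
open Finset
open scoped Classical

/-- Jensen's inequality for fiber sizes: a nondecreasing concave function summed over the sizes of
the fibers of a map into `ι` is at most `|ι|` times its value at the mean bound `T / |ι|`. -/
theorem ConcaveOn.sum_card_fiber_le {τ ι : Type*} [Fintype ι] [Nonempty ι] [DecidableEq ι]
    {f : ℝ → ℝ} (hconc : ConcaveOn ℝ (Set.Ici (0 : ℝ)) f) (hmono : MonotoneOn f (Set.Ici (0 : ℝ)))
    (s : Finset τ) (p : τ → ι) {N : ℝ} (hN : (s.card : ℝ) ≤ N) :
    ∑ q, f ((s.filter (fun t => p t = q)).card : ℝ) ≤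
      (Fintype.card ι : ℝ) * f (N / (Fintype.card ι : ℝ)) := by
  have hpos : (0 : ℝ) < Fintype.card ι := by exact_mod_cast Fintype.card_pos
  have hcard : ∑ q, ((s.filter (fun t => p t = q)).card : ℝ) = s.card := by
    exact_mod_cast (Finset.card_eq_sum_card_fiberwise (f := p) (s := s) (t := univ) (by simp)).symm
  have jensen := hconc.le_map_sum (t := univ) (w := fun _ : ι => (Fintype.card ι : ℝ)⁻¹)
    (p := fun q => ((s.filter (fun t => p t = q)).card : ℝ)) (fun _ _ => by positivity)
    (by simp [hpos.ne']) (fun _ _ => Set.mem_Ici.2 (Nat.cast_nonneg _))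
  simp only [smul_eq_mul, ← Finset.mul_sum, hcard] at jensen
  rw [← div_eq_inv_mul, ← div_eq_inv_mul, div_le_iff₀' hpos] at jensen
  refine jensen.trans (mul_le_mul_of_nonneg_left (hmono ?_ ?_ ?_) hpos.le)
  · exact Set.mem_Ici.2 (by positivity)
  · exact Set.mem_Ici.2 (div_nonneg ((Nat.cast_nonneg _).trans hN) hpos.le)
  · gcongr

/-- A linear functional that is `L`-Lipschitz in the `ℓ1` norm sums to at most `L * d * B` in
absolute value along a family whose coordinatewise sums are bounded by `B`. -/
theorem LinearMap.abs_sum_le_of_abs_coord_sum_le {τ : Type*} {d : ℕ} (V : (Fin d → ℝ) →ₗ[ℝ] ℝ)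
    {L : ℝ} (hL : 0 ≤ L) (hV : ∀ x, |V x| ≤ L * ∑ j, |x j|) (s : Finset τ) (v : τ → Fin d → ℝ)
    {B : ℝ} (hB : ∀ j, |∑ t ∈ s, v t j| ≤ B) :
    |∑ t ∈ s, V (v t)| ≤ L * (d * B) := by
  rw [← map_sum]
  refine (hV _).trans (mul_le_mul_of_nonneg_left ?_ hL)
  calc ∑ j, |(∑ t ∈ s, v t) j| ≤ ∑ _j : Fin d, B :=
        Finset.sum_le_sum fun j _ => by simpa [Finset.sum_apply] using hB j
    _ = d * B := by simp

/-- **One-round utility-improvement lemma for the action-feedback setting**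
(`lem:action_mh`).  An action conversation transcript over `T` days with finite
nonempty action set `A` and utility `U : A × ℝ^d → ℝ` linear and `L`-Lipschitz
(ℓ1) in its second argument: outcomes `y t ∈ [0,1]^d`, lengths `ℓ t ≥ 2`,
predictions `yh t k ∈ [0,1]^d` and communicated best-response actions
`b t k ∈ argmax_a U(a, yh t k)` for `1 ≤ k ≤ ℓ t`.  `T_k = {t | k ≤ ℓ t}`.
If the transcript obeys the `ε`-continuation rule and is
`f`-decision-conversation-calibrated at round `k ≥ 2`, then the extended
actions `b̄^{t,k} = b^{t, min(k, ℓ_t)}` satisfy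
`∑_t U(b̄^{t,k}, y_t) − ∑_t U(b̄^{t,k-1}, y_t) ≥ ε·|T_{k+1}| − 2Ld|A|²f(T/|A|²)`. -/
theorem action_one_round_improvement
    {A : Type} [Fintype A] [DecidableEq A] [Nonempty A]
    (d : ℕ) (hd : 1 ≤ d)
    (U : A → (Fin d → ℝ) → ℝ)
    (hlin : ∀ (a : A) (α β : ℝ) (x z : Fin d → ℝ),
      U a (α • x + β • z) = α * U a x + β * U a z)
    (L : ℝ) (hL : 0 ≤ L)
    (hlip : ∀ (a : A) (x z : Fin d → ℝ), |U a x - U a z| ≤ L * ∑ j, |x j - z j|)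
    (T : ℕ) (hT : 1 ≤ T)
    (ε : ℝ) (hε0 : 0 < ε) (hε1 : ε ≤ 1)
    (k : ℕ) (hk : 2 ≤ k)
    (y : Fin T → Fin d → ℝ) (hy : ∀ t j, y t j ∈ Set.Icc (0 : ℝ) 1)
    (ℓ : Fin T → ℕ) (hℓ : ∀ t, 2 ≤ ℓ t)
    (yh : Fin T → ℕ → Fin d → ℝ)
    (hyh : ∀ (t : Fin T) (k' : ℕ), 1 ≤ k' → k' ≤ ℓ t → ∀ j, yh t k' j ∈ Set.Icc (0 : ℝ) 1)
    (b : Fin T → ℕ → A)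
    (hb : ∀ (t : Fin T) (k' : ℕ), 1 ≤ k' → k' ≤ ℓ t →
      ∀ a : A, U a (yh t k') ≤ U (b t k') (yh t k'))
    -- the ε-continuation rule
    (hcont : ∀ (k' : ℕ), 2 ≤ k' → ∀ t : Fin T, k' ≤ ℓ t →
      (k' + 1 ≤ ℓ t ↔ ε ≤ U (b t k') (yh t k') - U (b t (k' - 1)) (yh t k')))
    -- f is a nonnegative nondecreasing concave function on [0,∞)
    (f : ℝ → ℝ) (hf0 : ∀ x : ℝ, 0 ≤ x → 0 ≤ f x)
    (hfmono : MonotoneOn f (Set.Ici (0 : ℝ)))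
    (hfconc : ConcaveOn ℝ (Set.Ici (0 : ℝ)) f)
    -- f-decision-conversation calibration at round k
    (hcal : ∀ a a' : A, ∀ j : Fin d,
      |∑ t ∈ univ.filter (fun t : Fin T => k ≤ ℓ t ∧ b t (k - 1) = a ∧ b t k = a'),
          (yh t k j - y t j)| ≤
        f ((univ.filter (fun t : Fin T => k ≤ ℓ t ∧ b t (k - 1) = a ∧ b t k = a')).card)) :
    ε * ((univ.filter (fun t : Fin T => k + 1 ≤ ℓ t)).card : ℝ)
        - 2 * L * d * (Fintype.card A : ℝ) ^ 2 * f (T / (Fintype.card A : ℝ) ^ 2) ≤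
      ∑ t : Fin T, U (b t (min k (ℓ t))) (y t)
        - ∑ t : Fin T, U (b t (min (k - 1) (ℓ t))) (y t) := by
  let V : A → (Fin d → ℝ) →ₗ[ℝ] ℝ := fun a =>
    { toFun := U a
      map_add' := fun x z => by simpa using hlin a 1 1 x z
      map_smul' := fun c x => by simpa using hlin a c 0 x 0 }
  have hVU : ∀ a x, U a x = V a x := fun _ _ => rfl
  have hV : ∀ a x, |V a x| ≤ L * ∑ j, |x j| := fun a x => by
    have h := hlip a x 0
    rw [hVU, hVU, map_zero] at h
    simpa using h
  let R : Finset (Fin T) := univ.filter (fun t => k ≤ ℓ t)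
  let p : Fin T → A × A := fun t => (b t (k - 1), b t k)
  let err : Fin T → ℝ := fun t =>
    V (b t k) (yh t k - y t) - V (b t (k - 1)) (yh t k - y t)
  have hfiber : ∀ a a' : A, R.filter (fun t => p t = (a, a')) =
      univ.filter (fun t : Fin T => k ≤ ℓ t ∧ b t (k - 1) = a ∧ b t k = a') := by
    intro a a'
    ext t
    simp [R, p]
  have herr_fiber : ∀ q : A × A, ∑ t ∈ R.filter (fun t => p t = q), err t ≤
      2 * L * d * f ((R.filter (fun t => p t = q)).card : ℝ) := by
    rintro ⟨a, a'⟩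
    have hbound : ∀ c, |∑ t ∈ R.filter (fun t => p t = (a, a')), V c (yh t k - y t)| ≤
        L * (d * f ((R.filter (fun t => p t = (a, a'))).card : ℝ)) := fun c =>
      (V c).abs_sum_le_of_abs_coord_sum_le hL (hV c) _ _ fun j => by
        rw [hfiber]
        exact hcal a a' j
    have hsplit : ∑ t ∈ R.filter (fun t => p t = (a, a')), err t =
        ∑ t ∈ R.filter (fun t => p t = (a, a')), V a' (yh t k - y t) -
          ∑ t ∈ R.filter (fun t => p t = (a, a')), V a (yh t k - y t) := by
      rw [← Finset.sum_sub_distrib]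
      refine Finset.sum_congr rfl fun t ht => ?_
      obtain ⟨h₁, h₂⟩ := Prod.mk.inj (Finset.mem_filter.1 ht).2
      simp only [err, h₁, h₂]
    rw [hsplit]
    linarith [(abs_le.1 (hbound a)).1, (abs_le.1 (hbound a')).2]
  have herr : ∑ t ∈ R, err t ≤
      2 * L * d * (Fintype.card A : ℝ) ^ 2 * f (T / (Fintype.card A : ℝ) ^ 2) := by
    have hJ := hfconc.sum_card_fiber_le hfmono R p (N := T)
      (by exact_mod_cast (Finset.card_le_univ R).trans_eq (Fintype.card_fin T))
    rw [Fintype.card_prod, Nat.cast_mul, ← sq] at hJ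
    calc ∑ t ∈ R, err t = ∑ q, ∑ t ∈ R.filter (fun t => p t = q), err t :=
          (Finset.sum_fiberwise R p err).symm
      _ ≤ ∑ q, 2 * L * d * f ((R.filter (fun t => p t = q)).card : ℝ) :=
          Finset.sum_le_sum fun q _ => herr_fiber q
      _ ≤ 2 * L * d * ((Fintype.card A : ℝ) ^ 2 * f (T / (Fintype.card A : ℝ) ^ 2)) := by
          rw [← Finset.mul_sum]
          exact mul_le_mul_of_nonneg_left hJ (by positivity)
      _ = _ := by ring
  have hday : ∀ t, (if k + 1 ≤ ℓ t then ε else 0) - (if k ≤ ℓ t then err t else 0) ≤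
      U (b t (min k (ℓ t))) (y t) - U (b t (min (k - 1) (ℓ t))) (y t) := by
    intro t
    by_cases hkt : k ≤ ℓ t
    · have hbest := hb t k (by omega) hkt (b t (k - 1))
      have hrule := hcont k hk t hkt
      rw [if_pos hkt, min_eq_left hkt, min_eq_left (show k - 1 ≤ ℓ t by omega)]
      simp only [hVU, err, map_sub] at hbest hrule ⊢
      split_ifs with h
      · linarith [hrule.1 h]
      · linarith
    · rw [if_neg hkt, if_neg (by omega), min_eq_right (show ℓ t ≤ k by omega),
        min_eq_right (show ℓ t ≤ k - 1 by omega)]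
      simp
  have hsum := Finset.sum_le_sum fun t (_ : t ∈ univ) => hday t
  rw [Finset.sum_sub_distrib, Finset.sum_sub_distrib, ← Finset.sum_filter,
    ← Finset.sum_filter, Finset.sum_const, nsmul_eq_mul] at hsum
  linarith [show ∑ t ∈ univ.filter (fun t => k ≤ ℓ t), err t = ∑ t ∈ R, err t from rfl]
end

section
/- Let S be a finite index set and p, q, y : S → [0,1]. Suppose q is perfectly calibrated conditionally on the exact values of p, i.e., for all v, v' ∈ [0,1]: ∑_{t ∈ S : q_t = v and p_t = v'} (v − y_t) = 0. Then ∑_{t∈S} (p_t − y_t)² − ∑_{t∈S} (q_t − y_t)² = ∑_{t∈S} (p_t − q_t)². In particular, the squared error of q is at most that of p, with the gap exactly equal to the total squared disagreement between p and q. -/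
open Finset
open scoped Classical

/-- If the residuals `q - y` sum to zero on every joint level set of `(q, p)`, then they are
orthogonal to every function of `(q, p)`. -/
theorem sum_mul_sub_eq_zero_of_calibrated {ι : Type*} (S : Finset ι) (p q y : ι → ℝ)
    (hcal : ∀ s ∈ S, ∑ t ∈ S, (if q t = q s ∧ p t = p s then q s - y t else 0) = 0)
    (g : ℝ → ℝ → ℝ) :
    ∑ t ∈ S, g (q t) (p t) * (q t - y t) = 0 := by
  rw [← sum_fiberwise_of_maps_to
    (fun t ht => mem_image_of_mem (fun t => (q t, p t)) ht)]
  refine sum_eq_zero fun a ha => ?_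
  obtain ⟨s, hs, rfl⟩ := mem_image.mp ha
  calc ∑ t ∈ S with (q t, p t) = (q s, p s), g (q t) (p t) * (q t - y t)
      = g (q s) (p s) * ∑ t ∈ S, (if q t = q s ∧ p t = p s then q s - y t else 0) := by
        rw [sum_filter, mul_sum]
        refine sum_congr rfl fun t _ => ?_
        by_cases h : q t = q s ∧ p t = p s <;> simp [h]
    _ = 0 := by rw [hcal s hs, mul_zero]

/-- **Exact squared-error identity for conditionally calibrated predictions**
(the core of the potential argument, cf. `lem:squares_diff`/`lem:mh`).  If `q`
is perfectly calibrated conditionally on the exact values of `p` — i.e.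
`∑_{t ∈ S : q_t = v, p_t = v'} (v − y_t) = 0` for all `v, v' ∈ [0,1]` — then
`SQE(p) − SQE(q) = ∑ (p_t − q_t)²`; in particular `SQE(q) ≤ SQE(p)`. -/
theorem calibrated_squared_error_identity
    {ι : Type} [DecidableEq ι] (S : Finset ι)
    (p q y : ι → ℝ)
    (hp : ∀ t ∈ S, p t ∈ Set.Icc (0 : ℝ) 1)
    (hq : ∀ t ∈ S, q t ∈ Set.Icc (0 : ℝ) 1)
    (hy : ∀ t ∈ S, y t ∈ Set.Icc (0 : ℝ) 1)
    (hcal : ∀ v ∈ Set.Icc (0 : ℝ) 1, ∀ v' ∈ Set.Icc (0 : ℝ) 1,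
      ∑ t ∈ S, (if q t = v ∧ p t = v' then v - y t else 0) = 0) :
    (∑ t ∈ S, (p t - y t) ^ 2 - ∑ t ∈ S, (q t - y t) ^ 2 = ∑ t ∈ S, (p t - q t) ^ 2) ∧
    ∑ t ∈ S, (q t - y t) ^ 2 ≤ ∑ t ∈ S, (p t - y t) ^ 2 := by
  have horth := sum_mul_sub_eq_zero_of_calibrated S p q y
    (fun s hs => by convert hcal (q s) (hq s hs) (p s) (hp s hs)) (fun v v' => 2 * (v' - v))
  have hid : ∑ t ∈ S, (p t - y t) ^ 2 - ∑ t ∈ S, (q t - y t) ^ 2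
      = ∑ t ∈ S, (p t - q t) ^ 2 := by
    rw [← add_zero (∑ t ∈ S, (p t - q t) ^ 2), ← horth, ← sum_sub_distrib, ← sum_add_distrib]
    exact sum_congr rfl fun t _ => by ring
  exact ⟨hid, sub_nonneg.mp (hid ▸ sum_nonneg fun t _ => sq_nonneg (p t - q t))⟩
end

section
/- Let A be a finite nonempty action set, d ≥ 1, and U : A × ℝ^d → ℝ linear in its second argument. Let S be a finite index set, ŷ, y : S → [0,1]^d, a : S → A, and b : S → A with b_t ∈ argmax_{a'∈A} U(a', ŷ_t) for every t ∈ S. Suppose perfect decision calibration holds: for every pair (a₀, a₁) ∈ A × A and every coordinate j ∈ {1,…,d}, ∑_{t ∈ S : a_t = a₀ and b_t = a₁} (ŷ_t[j] − y_t[j]) = 0. Then ∑_{t∈S} (U(b_t, y_t) − U(a_t, y_t)) = ∑_{t∈S} (U(b_t, ŷ_t) − U(a_t, ŷ_t)) ≥ 0. -/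
open Finset
open scoped Classical

/-- If the vectors `v t` sum to zero over every fiber of `k`, then so do their images under
linear maps that depend on `t` only through `k t`. -/
theorem sum_linearMap_eq_zero_of_fiberwise {ι κ R M N : Type*} [Fintype κ] [DecidableEq κ]
    [Semiring R] [AddCommMonoid M] [AddCommMonoid N] [Module R M] [Module R N]
    (S : Finset ι) (k : ι → κ) (L : κ → M →ₗ[R] N) (v : ι → M)
    (h : ∀ c, ∑ t ∈ S with k t = c, v t = 0) :
    ∑ t ∈ S, L (k t) (v t) = 0 := by
  rw [← Finset.sum_fiberwise S k]
  refine Finset.sum_eq_zero fun c _ => ?_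
  rw [← map_zero (L c), ← h c, map_sum]
  refine Finset.sum_congr rfl fun t ht => ?_
  rw [(Finset.mem_filter.mp ht).2]

/-- **Exact utility identity for perfectly decision-calibrated forecasts**
(the core of the utility-improvement argument in the action-feedback
agreement protocol).  `U` is linear in its second argument, `a_t` is the
action recommended by the other party, `yh_t` a forecast with best-response
action `b_t`, and perfect decision calibration holds: for every pair of
actions `(a₀, a₁)` and coordinate `j`,
`∑_{t ∈ S : a_t = a₀, b_t = a₁} (yh_t[j] − y_t[j]) = 0`.  Then the realized
utility gap equals the forecasted utility gap, which is nonnegative. -/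
theorem decision_calibrated_utility_identity
    {A : Type} [Fintype A] [DecidableEq A] [Nonempty A]
    (d : ℕ) (hd : 1 ≤ d)
    (U : A → (Fin d → ℝ) → ℝ)
    (hlin : ∀ (a : A) (α β : ℝ) (x z : Fin d → ℝ),
      U a (α • x + β • z) = α * U a x + β * U a z)
    {ι : Type} [DecidableEq ι] (S : Finset ι)
    (yh y : ι → Fin d → ℝ)
    (hyh : ∀ t ∈ S, ∀ j, yh t j ∈ Set.Icc (0 : ℝ) 1)
    (hy : ∀ t ∈ S, ∀ j, y t j ∈ Set.Icc (0 : ℝ) 1)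
    (a b : ι → A)
    (hb : ∀ t ∈ S, ∀ a' : A, U a' (yh t) ≤ U (b t) (yh t))
    -- perfect decision calibration
    (hcal : ∀ a₀ a₁ : A, ∀ j : Fin d,
      ∑ t ∈ S, (if a t = a₀ ∧ b t = a₁ then yh t j - y t j else 0) = 0) :
    (∑ t ∈ S, (U (b t) (y t) - U (a t) (y t)) =
        ∑ t ∈ S, (U (b t) (yh t) - U (a t) (yh t))) ∧
    0 ≤ ∑ t ∈ S, (U (b t) (yh t) - U (a t) (yh t)) := by
  refine ⟨?_, Finset.sum_nonneg fun t ht => sub_nonneg.mpr (hb t ht (a t))⟩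
  let L : A → (Fin d → ℝ) →ₗ[ℝ] ℝ := fun c =>
    { toFun := U c
      map_add' := fun x z => by simpa using hlin c 1 1 x z
      map_smul' := fun r x => by simpa using hlin c r 0 x 0 }
  have key := sum_linearMap_eq_zero_of_fiberwise S (fun t => (a t, b t))
    (fun c => L c.2 - L c.1) (fun t => yh t - y t) (by
      rintro ⟨a₀, a₁⟩
      ext j
      simpa [Finset.sum_filter, Finset.sum_apply, -Finset.sum_sub_distrib] using hcal a₀ a₁ j)
  simp only [LinearMap.sub_apply, map_sub] at key
  rw [eq_comm, ← sub_eq_zero, ← Finset.sum_sub_distrib, ← key]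
  rfl
end

section
/- Let p₁, y₁ ∈ [0,1]^{T₁} and p₂, y₂ ∈ [0,1]^{T₂}, and let p = p₁ ⧺ p₂ and y = y₁ ⧺ y₂ be their concatenations of length T₁ + T₂. Then CalDist(p, y) ≤ CalDist(p₁, y₁) + CalDist(p₂, y₂), i.e., distance to calibration is subadditive under concatenation of prediction/outcome sequences. -/
open Finset
open scoped Classical

/-- A sequence `q : Fin m → [0,1]` is perfectly calibrated against outcomes `y`
if for every `v ∈ [0,1]`, `∑_{t : q_t = v} (v − y_t) = 0`. -/
def PerfectlyCalibrated (m : ℕ) (q y : Fin m → ℝ) : Prop :=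
  (∀ t, q t ∈ Set.Icc (0 : ℝ) 1) ∧
    ∀ v ∈ Set.Icc (0 : ℝ) 1, ∑ t, (if q t = v then v - y t else 0) = 0

/-- The distance to calibration of predictions `p` against outcomes `y`: the
infimum over perfectly calibrated sequences `q` of `∑_t |p_t − q_t|`. -/
noncomputable def calDist (m : ℕ) (p y : Fin m → ℝ) : ℝ :=
  sInf {c : ℝ | ∃ q : Fin m → ℝ, PerfectlyCalibrated m q y ∧ c = ∑ t, |p t - q t|}

/-- The outcomes themselves are perfectly calibrated. -/
theorem perfectlyCalibrated_self {m : ℕ} {y : Fin m → ℝ}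
    (hy : ∀ t, y t ∈ Set.Icc (0 : ℝ) 1) : PerfectlyCalibrated m y y := by
  refine ⟨hy, fun v _ => Finset.sum_eq_zero fun t _ => ?_⟩
  split_ifs with h
  · rw [h, sub_self]
  · rfl

/-- The concatenation of two perfectly calibrated sequences is perfectly calibrated. -/
theorem PerfectlyCalibrated.append {m n : ℕ} {q₁ y₁ : Fin m → ℝ} {q₂ y₂ : Fin n → ℝ}
    (h₁ : PerfectlyCalibrated m q₁ y₁) (h₂ : PerfectlyCalibrated n q₂ y₂) :
    PerfectlyCalibrated (m + n) (Fin.append q₁ q₂) (Fin.append y₁ y₂) := by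
  refine ⟨fun t => ?_, fun v hv => ?_⟩
  · refine Fin.addCases (fun i => ?_) (fun i => ?_) t
    · simpa only [Fin.append_left] using h₁.1 i
    · simpa only [Fin.append_right] using h₂.1 i
  · simp only [Fin.sum_univ_add, Fin.append_left, Fin.append_right]
    rw [h₁.2 v hv, h₂.2 v hv, add_zero]

/-- The distance to calibration is at most the distance to any perfectly calibrated sequence. -/
theorem calDist_le {m : ℕ} {q y : Fin m → ℝ} (p : Fin m → ℝ) (h : PerfectlyCalibrated m q y) :
    calDist m p y ≤ ∑ t, |p t - q t| := by
  refine csInf_le ⟨0, ?_⟩ ⟨q, h, rfl⟩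
  rintro _ ⟨r, -, rfl⟩
  exact Finset.sum_nonneg fun t _ => abs_nonneg _

/-- A lower bound for the distances to all perfectly calibrated sequences bounds `calDist`. -/
theorem le_calDist {m : ℕ} {p y : Fin m → ℝ} {c : ℝ} (hy : ∀ t, y t ∈ Set.Icc (0 : ℝ) 1)
    (h : ∀ q, PerfectlyCalibrated m q y → c ≤ ∑ t, |p t - q t|) : c ≤ calDist m p y := by
  refine le_csInf ⟨_, y, perfectlyCalibrated_self hy, rfl⟩ ?_
  rintro _ ⟨q, hq, rfl⟩
  exact h q hq

/-- **Distance to calibration is subadditive under concatenation** of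
prediction/outcome sequences. -/
theorem calDist_concat_subadditive
    (T₁ T₂ : ℕ)
    (p₁ y₁ : Fin T₁ → ℝ) (p₂ y₂ : Fin T₂ → ℝ)
    (hp₁ : ∀ t, p₁ t ∈ Set.Icc (0 : ℝ) 1) (hy₁ : ∀ t, y₁ t ∈ Set.Icc (0 : ℝ) 1)
    (hp₂ : ∀ t, p₂ t ∈ Set.Icc (0 : ℝ) 1) (hy₂ : ∀ t, y₂ t ∈ Set.Icc (0 : ℝ) 1) :
    calDist (T₁ + T₂) (Fin.append p₁ p₂) (Fin.append y₁ y₂) ≤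
      calDist T₁ p₁ y₁ + calDist T₂ p₂ y₂ := by
  rw [← sub_le_iff_le_add]
  refine le_calDist hy₁ fun q₁ h₁ => ?_
  rw [sub_le_comm]
  refine le_calDist hy₂ fun q₂ h₂ => ?_
  rw [sub_le_iff_le_add']
  simpa only [Fin.sum_univ_add, Fin.append_left, Fin.append_right] using
    calDist_le (Fin.append p₁ p₂) (h₁.append h₂)
end

section
/- Fix T ≥ 1, n ≥ 1, and sequences of predictions p ∈ [0,1]^T and outcomes y ∈ [0,1]^T. Then there exists a sequence q ∈ [0,1]^T that is perfectly calibrated against y and satisfies ∑_{t=1}^T |p_t − q_t| ≤ ECE(p, y; n) + T/n. Consequently, CalDist(p, y) ≤ ECE(p, y; n) + T/n. -/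
open Finset
open scoped Classical

/-- Membership in the `i`-th bucket of coarseness `n`:
`B_n(i) = [(i−1)/n, i/n)` for `i < n`, and `B_n(n) = [(n−1)/n, 1]`. -/
def InBucketN (n i : ℕ) (x : ℝ) : Prop :=
  if i = n then ((n : ℝ) - 1) / n ≤ x ∧ x ≤ 1
  else ((i : ℝ) - 1) / n ≤ x ∧ x < (i : ℝ) / n

/-- The bucketed expected calibration error with coarseness `n`:
`ECE(p, y; n) = ∑_{i=1}^n |∑_{t : p_t ∈ B_n(i)} (p_t − y_t)|`. -/
noncomputable def ECE (T n : ℕ) (p y : Fin T → ℝ) : ℝ :=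
  ∑ i ∈ Finset.Icc 1 n, |∑ t, (if InBucketN n i (p t) then p t - y t else 0)|

/-- The mean of `f` over a finite set `s`, as a real number. -/
noncomputable def finsetMean {ι : Type*} (s : Finset ι) (f : ι → ℝ) : ℝ :=
  (∑ t ∈ s, f t) / #s

lemma card_mul_finsetMean {ι : Type*} (s : Finset ι) (f : ι → ℝ) :
    #s * finsetMean s f = ∑ t ∈ s, f t := by
  rcases s.eq_empty_or_nonempty with rfl | hs
  · simp
  · have : (#s : ℝ) ≠ 0 := by exact_mod_cast hs.card_ne_zero
    rw [finsetMean, mul_div_cancel₀ _ this]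

lemma finsetMean_mem_Icc {ι : Type*} {s : Finset ι} (hs : s.Nonempty) {f : ι → ℝ} {a b : ℝ}
    (hf : ∀ t ∈ s, f t ∈ Set.Icc a b) : finsetMean s f ∈ Set.Icc a b := by
  have hc : (0 : ℝ) < #s := by exact_mod_cast hs.card_pos
  have hl := s.card_nsmul_le_sum f a fun t ht => (hf t ht).1
  have hu := s.sum_le_card_nsmul f b fun t ht => (hf t ht).2
  rw [nsmul_eq_mul] at hl hu
  rw [finsetMean, Set.mem_Icc, le_div_iff₀ hc, div_le_iff₀ hc]
  constructor <;> linarith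

lemma sum_abs_sub_finsetMean_le {ι : Type*} (s : Finset ι) {p y : ι → ℝ} {a b : ℝ}
    (hp : ∀ t ∈ s, p t ∈ Set.Icc a b) :
    ∑ t ∈ s, |p t - finsetMean s y| ≤ |∑ t ∈ s, (p t - y t)| + #s * (b - a) := by
  have hgap : |∑ t ∈ s, (p t - y t)| = ∑ _t ∈ s, |finsetMean s p - finsetMean s y| := by
    rw [sum_const, nsmul_eq_mul, sum_sub_distrib, ← card_mul_finsetMean s p,
      ← card_mul_finsetMean s y, ← mul_sub, abs_mul, Nat.abs_cast]
  rw [hgap, ← nsmul_eq_mul, ← sum_const, ← sum_add_distrib]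
  refine sum_le_sum fun t ht => ?_
  have hm := finsetMean_mem_Icc ⟨t, ht⟩ hp
  have hd : |p t - finsetMean s p| ≤ b - a :=
    abs_sub_le_iff.2 ⟨by linarith [(hp t ht).2, hm.1], by linarith [(hp t ht).1, hm.2]⟩
  linarith [abs_sub_le (p t) (finsetMean s p) (finsetMean s y)]

/-- Predicting the mean outcome on each fiber of `b` is perfectly calibrated. -/
lemma perfectlyCalibrated_finsetMean {T : ℕ} {y : Fin T → ℝ}
    (hy : ∀ t, y t ∈ Set.Icc (0 : ℝ) 1) (b : Fin T → ℕ) :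
    PerfectlyCalibrated T (fun t => finsetMean {s | b s = b t} y) y := by
  refine ⟨fun t => finsetMean_mem_Icc ⟨t, by simp⟩ fun s _ => hy s, fun v _ => ?_⟩
  rw [← sum_fiberwise_of_maps_to (g := b) (t := univ.image b) fun t _ => by simp]
  refine sum_eq_zero fun k _ => ?_
  have hfib : ∀ t ∈ ({t | b t = k} : Finset (Fin T)),
      (if finsetMean {s | b s = b t} y = v then v - y t else 0) =
        if finsetMean {s | b s = k} y = v then v - y t else 0 := by
    intro t ht
    rw [(mem_filter.1 ht).2]
  rw [sum_congr rfl hfib]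
  split_ifs with h
  · rw [sum_sub_distrib, sum_const, nsmul_eq_mul, ← card_mul_finsetMean _ y, h, sub_self]
  · simp

lemma InBucketN.mem_Icc {n i : ℕ} (hn : 1 ≤ n) {x : ℝ} (h : InBucketN n i x) :
    x ∈ Set.Icc (((i : ℝ) - 1) / n) (i / n) := by
  unfold InBucketN at h
  split_ifs at h with hi
  · subst hi
    have : (i : ℝ) ≠ 0 := by positivity
    exact ⟨h.1, by rw [div_self this]; exact h.2⟩
  · exact ⟨h.1, h.2.le⟩

/-- The buckets with indices in `{1, …, n}` partition `[0,1]`. -/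
lemma exists_bucket_index {n : ℕ} (hn : 1 ≤ n) {x : ℝ} (hx : x ∈ Set.Icc (0 : ℝ) 1) :
    ∃ k ∈ Finset.Icc 1 n, ∀ i ∈ Finset.Icc 1 n, InBucketN n i x ↔ k = i := by
  have hn0 : (0 : ℝ) < n := by exact_mod_cast hn
  have hnx : 0 ≤ x * n := mul_nonneg hx.1 hn0.le
  refine ⟨min n (⌊x * n⌋₊ + 1), by simp [hn], fun i hi => ?_⟩
  obtain ⟨hi1, hin⟩ := Finset.mem_Icc.1 hi
  have hlow : ((i : ℝ) - 1) / n ≤ x ↔ i - 1 ≤ ⌊x * n⌋₊ := by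
    rw [div_le_iff₀ hn0, Nat.le_floor_iff hnx, Nat.cast_sub hi1, Nat.cast_one]
  have hupp : x < (i : ℝ) / n ↔ ⌊x * n⌋₊ < i := by
    rw [lt_div_iff₀ hn0, Nat.floor_lt hnx]
  unfold InBucketN
  split_ifs with h
  · subst h
    rw [hlow, and_iff_left hx.2]
    omega
  · rw [hlow, hupp]
    omega

/-- **Distance to calibration is bounded by bucketed ECE plus the bucket
width** (`lem:distance-to-bucketed`): there is a perfectly calibrated `q`
with `∑ |p_t − q_t| ≤ ECE(p, y; n) + T/n`, and consequently
`CalDist(p, y) ≤ ECE(p, y; n) + T/n`. -/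
theorem calDist_le_bucketed_ECE
    (T n : ℕ) (hT : 1 ≤ T) (hn : 1 ≤ n)
    (p y : Fin T → ℝ)
    (hp : ∀ t, p t ∈ Set.Icc (0 : ℝ) 1) (hy : ∀ t, y t ∈ Set.Icc (0 : ℝ) 1) :
    (∃ q : Fin T → ℝ, PerfectlyCalibrated T q y ∧
      ∑ t, |p t - q t| ≤ ECE T n p y + T / n) ∧
    calDist T p y ≤ ECE T n p y + T / n := by
  obtain ⟨q, hq, hle⟩ : ∃ q : Fin T → ℝ, PerfectlyCalibrated T q y ∧
      ∑ t, |p t - q t| ≤ ECE T n p y + T / n := by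
    choose b hb hbi using fun t => exists_bucket_index hn (hp t)
    refine ⟨_, perfectlyCalibrated_finsetMean hy b, ?_⟩
    have hcard : (T : ℝ) = ∑ i ∈ Finset.Icc 1 n, (#{t | b t = i} : ℝ) := by
      have := card_eq_sum_card_fiberwise (f := b) (s := univ) (t := Finset.Icc 1 n)
        fun t _ => hb t
      rw [card_univ, Fintype.card_fin] at this
      exact_mod_cast this
    rw [ECE, hcard, sum_div, ← sum_add_distrib,
      ← sum_fiberwise_of_maps_to (g := b) (t := Finset.Icc 1 n) fun t _ => hb t]
    refine sum_le_sum fun i hi => ?_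
    have hmem : ∀ t ∈ ({t | b t = i} : Finset (Fin T)),
        p t ∈ Set.Icc (((i : ℝ) - 1) / n) (i / n) := fun t ht =>
      ((hbi t i hi).2 (mem_filter.1 ht).2).mem_Icc hn
    have hbound := sum_abs_sub_finsetMean_le {t | b t = i} (y := y) hmem
    have hece : ∑ t, (if InBucketN n i (p t) then p t - y t else 0) =
        ∑ t with b t = i, (p t - y t) := by
      rw [sum_filter]
      exact sum_congr rfl fun t _ => by simp only [hbi t i hi]
    have hwidth : (i : ℝ) / n - ((i : ℝ) - 1) / n = 1 / n := by ring
    rw [hwidth, mul_one_div] at hbound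
    rw [hece]
    refine le_trans (le_of_eq (sum_congr rfl fun t ht => ?_)) hbound
    rw [(mem_filter.1 ht).2]
  refine ⟨⟨q, hq, hle⟩, le_trans (csInf_le ⟨0, ?_⟩ ⟨q, hq, rfl⟩) hle⟩
  rintro c ⟨r, -, rfl⟩
  positivity
end

section
/- Let T ≥ 1 and let p, q, y ∈ [0,1]^T with p perfectly calibrated against y and ∑_{t=1}^T |p_t − q_t| ≤ γ. Then ∑_{t=1}^T (q_t − y_t)² − ∑_{t=1}^T (p_t − y_t)² ≤ 3γ. -/
open Finset
open scoped Classical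

/-- On `[0,1]`, the squared error is `2`-Lipschitz in the prediction. -/
lemma sq_sub_sub_sq_sub_le_two_mul_abs {a b c : ℝ} (ha : a ∈ Set.Icc (0 : ℝ) 1)
    (hb : b ∈ Set.Icc (0 : ℝ) 1) (hc : c ∈ Set.Icc (0 : ℝ) 1) :
    (b - c) ^ 2 - (a - c) ^ 2 ≤ 2 * |a - b| := by
  obtain ⟨ha0, ha1⟩ := ha
  obtain ⟨hb0, hb1⟩ := hb
  obtain ⟨hc0, hc1⟩ := hc
  have h2 : |a + b - 2 * c| ≤ 2 := abs_le.2 ⟨by linarith, by linarith⟩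
  calc (b - c) ^ 2 - (a - c) ^ 2 = -((a + b - 2 * c) * (a - b)) := by ring
    _ ≤ |(a + b - 2 * c) * (a - b)| := neg_le_abs _
    _ = |a + b - 2 * c| * |a - b| := abs_mul _ _
    _ ≤ 2 * |a - b| := by gcongr

/-- **Squared error is stable under ℓ1 perturbations of calibrated
predictions** (`lem:bound_error_diff`): if `p ∈ [0,1]^T` is perfectly
calibrated against `y ∈ [0,1]^T` (for every `v ∈ [0,1]`,
`∑_{t : p_t = v} (v − y_t) = 0`) and `q ∈ [0,1]^T` satisfies
`∑ |p_t − q_t| ≤ γ`, then `∑ (q_t − y_t)² − ∑ (p_t − y_t)² ≤ 3γ`. -/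
theorem squared_error_close_to_calibrated
    (T : ℕ) (hT : 1 ≤ T) (γ : ℝ)
    (p q y : Fin T → ℝ)
    (hp : ∀ t, p t ∈ Set.Icc (0 : ℝ) 1)
    (hq : ∀ t, q t ∈ Set.Icc (0 : ℝ) 1)
    (hy : ∀ t, y t ∈ Set.Icc (0 : ℝ) 1)
    (hcal : ∀ v ∈ Set.Icc (0 : ℝ) 1, ∑ t, (if p t = v then v - y t else 0) = 0)
    (hclose : ∑ t, |p t - q t| ≤ γ) :
    ∑ t, (q t - y t) ^ 2 - ∑ t, (p t - y t) ^ 2 ≤ 3 * γ := by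
  have hγ : 0 ≤ γ := (Finset.sum_nonneg fun t _ => abs_nonneg (p t - q t)).trans hclose
  have hsum : ∑ t, (q t - y t) ^ 2 - ∑ t, (p t - y t) ^ 2 ≤ 2 * ∑ t, |p t - q t| := by
    rw [← Finset.sum_sub_distrib, Finset.mul_sum]
    exact Finset.sum_le_sum fun t _ => sq_sub_sub_sq_sub_le_two_mul_abs (hp t) (hq t) (hy t)
  linarith
end
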